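/- On every fan Δ there exists a minimal extension sheaf E•. -/

import Mathlib

open Module Function

set_option synthInstance.maxHeartbeats 1000000
set_option maxHeartbeats 1000000
set_option maxSynthPendingDepth 3

noncomputable section

/-! ## Cones and fans -/

/-- The convex cone generated by a finite set of vectors. -/
def coneGen {V : Type} [AddCommGroup V] [Module ℝ V] (s : Finset V) : Set V :=
  { x | ∃ c : V → ℝ, (∀ v ∈ s, 0 ≤ c v) ∧ x = ∑ v ∈ s, c v • v }

/-- A (strictly convex, i.e. pointed) polyhedral cone in a real vector space. -/
structure Cone (V : Type) [AddCommGroup V] [Module ℝ V] where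
  carrier : Set V
  isPoly : ∃ s : Finset V, carrier = coneGen s
  pointed : ∀ x ∈ carrier, -x ∈ carrier → x = 0

namespace Cone

variable {V : Type} [AddCommGroup V] [Module ℝ V]

/-- The linear span `V_σ` of a cone. -/
def spanC (σ : Cone V) : Submodule ℝ V := Submodule.span ℝ σ.carrier

/-- The dimension of a cone. -/
def dim (σ : Cone V) : ℕ := Module.finrank ℝ σ.spanC

/-- `τ` is a face of `σ` (cut out by a supporting linear form); `σ` is a face of itself. -/
def IsFaceOf (τ σ : Cone V) : Prop :=
  ∃ f : V →ₗ[ℝ] ℝ, (∀ x ∈ σ.carrier, 0 ≤ f x) ∧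
    τ.carrier = σ.carrier ∩ {x | f x = 0}

def IsProperFaceOf (τ σ : Cone V) : Prop := τ.IsFaceOf σ ∧ τ ≠ σ

/-- A cone is simplicial if it is generated by linearly independent vectors. -/
def IsSimplicial (σ : Cone V) : Prop :=
  ∃ s : Finset V, (LinearIndependent ℝ (fun v : s => (v : V))) ∧ σ.carrier = coneGen s

end Cone

/-- The zero cone `o`. -/
def zeroCone (V : Type) [AddCommGroup V] [Module ℝ V] : Cone V where
  carrier := {0}
  isPoly := ⟨∅, by ext x; simp [coneGen]⟩
  pointed := by intro x hx _; simpa using hx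

/-- A fan in `V`: a finite collection of pointed polyhedral cones, closed under taking
faces, such that the intersection of any two cones is a common face of both. -/
structure Fan (V : Type) [AddCommGroup V] [Module ℝ V] where
  cones : Set (Cone V)
  finite : cones.Finite
  zero_mem : zeroCone V ∈ cones
  face_mem : ∀ σ ∈ cones, ∀ τ : Cone V, τ.IsFaceOf σ → τ ∈ cones
  inter_mem : ∀ σ ∈ cones, ∀ σ' ∈ cones, ∃ τ ∈ cones,
    τ.IsFaceOf σ ∧ τ.IsFaceOf σ' ∧ τ.carrier = σ.carrier ∩ σ'.carrier

namespace Fan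

variable {V : Type} [AddCommGroup V] [Module ℝ V]

/-- A subfan of `Δ`: a subset of the cones closed under taking faces.  The subfans are
exactly the open subsets of the fan topology. -/
def IsSubfan (Δ : Fan V) (Λ : Set (Cone V)) : Prop :=
  Λ ⊆ Δ.cones ∧ ∀ σ ∈ Λ, ∀ τ : Cone V, τ.IsFaceOf σ → τ ∈ Λ

/-- The support `|Δ|` of a fan. -/
def support (Δ : Fan V) : Set V := ⋃ σ ∈ Δ.cones, σ.carrier

/-- A fan is complete if its support is the whole space. -/
def IsComplete (Δ : Fan V) : Prop := Δ.support = Set.univ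

/-- A fan is simplicial if all its cones are. -/
def IsSimplicial (Δ : Fan V) : Prop := ∀ σ ∈ Δ.cones, σ.IsSimplicial

/-- A fan is purely `n`-dimensional if every cone is a face of an `n`-dimensional cone. -/
def IsPurely (Δ : Fan V) (n : ℕ) : Prop :=
  ∀ σ ∈ Δ.cones, ∃ σ' ∈ Δ.cones, σ.IsFaceOf σ' ∧ σ'.dim = n

/-- The boundary subfan `∂Δ`: the cones supported in the topological boundary of `|Δ|`. -/
def boundary [TopologicalSpace V] (Δ : Fan V) : Set (Cone V) :=
  {τ ∈ Δ.cones | τ.carrier ⊆ frontier Δ.support}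

end Fan

/-! ## The graded algebra `A•` of polynomial functions (linear forms in degree 2) -/

/-- The algebra of polynomial functions on `V`, i.e. the subalgebra of `V → ℝ`
generated by the linear forms. -/
def polyAlg (V : Type) [AddCommGroup V] [Module ℝ V] : Subalgebra ℝ (V → ℝ) :=
  Algebra.adjoin ℝ {f : V → ℝ | IsLinearMap ℝ f}

/-- `A• = S•(V*)` as a commutative ring. -/
abbrev PolyRing (V : Type) [AddCommGroup V] [Module ℝ V] : Type := polyAlg V

variable (V : Type) [AddCommGroup V] [Module ℝ V]

/-- Polynomial functions homogeneous of (topological) degree `2k`. -/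
def AdegN (k : ℕ) : Submodule ℝ (PolyRing V) where
  carrier := {f | ∀ (t : ℝ) (x : V), (f : V → ℝ) (t • x) = t ^ k * (f : V → ℝ) x}
  add_mem' := by intro f g hf hg t x; simp [hf t x, hg t x]; ring
  zero_mem' := by intro t x; simp
  smul_mem' := by intro c f hf t x; simp [hf t x]; ring

/-- The degree-`q` part `A^q` of `A•`, with linear forms in degree `2`
(so `A^q = 0` for odd `q`). -/
def Adeg (q : ℤ) : Submodule ℝ (PolyRing V) :=
  ⨆ (k : ℕ) (_ : q = 2 * k), AdegN V k

/-- Evaluation of a polynomial function at a point, as a ring homomorphism. -/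
def evalRH (x : V) : PolyRing V →+* ℝ :=
  (Pi.evalRingHom (fun _ : V => ℝ) x).comp (polyAlg V).val.toRingHom

/-- The maximal graded ideal `m = A^{>0}` of polynomial functions vanishing at the origin. -/
def mId : Ideal (PolyRing V) := RingHom.ker (evalRH V 0)

/-- The ideal of polynomial functions vanishing on a subset `s ⊆ V`;
for `s = σ` a cone, `A•/I(σ) = A•_σ = S•(V_σ*)`. -/
def vanishingIdeal (s : Set V) : Ideal (PolyRing V) :=
  RingHom.ker (Pi.ringHom (fun x : s => evalRH V x.1))

/-- `A•_σ`, realized as the quotient of `A•` by the functions vanishing on `σ`. -/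
abbrev coneRing (σ : Cone V) : Type := PolyRing V ⧸ vanishingIdeal V σ.carrier

/-! ## Graded `A•`-modules -/

/-- A graded `A•`-module (with real structure): an `A•`-module with an internal
`ℤ`-grading by real subspaces, compatible with the grading of `A•`. -/
structure GAMod where
  M : Type
  [acg : AddCommGroup M]
  [modA : Module (PolyRing V) M]
  [modR : Module ℝ M]
  [tower : IsScalarTower ℝ (PolyRing V) M]
  deg : ℤ → Submodule ℝ M
  internal : DirectSum.IsInternal deg
  smul_deg : ∀ (p q : ℤ), ∀ a ∈ Adeg V p, ∀ x ∈ deg q, a • x ∈ deg (p + q)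

attribute [instance] GAMod.acg GAMod.modA GAMod.modR GAMod.tower

variable {V}

/-- A homomorphism of graded `A•`-modules, homogeneous of degree 0. -/
structure GHom (M N : GAMod V) where
  toLin : M.M →ₗ[PolyRing V] N.M
  deg_mem : ∀ q : ℤ, ∀ x ∈ M.deg q, toLin x ∈ N.deg q

def GHom.id (M : GAMod V) : GHom M M := ⟨LinearMap.id, fun _ _ h => h⟩

def GHom.comp {M N P : GAMod V} (g : GHom N P) (f : GHom M N) : GHom M P :=
  ⟨g.toLin ∘ₗ f.toLin, fun q x hx => g.deg_mem q _ (f.deg_mem q x hx)⟩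

variable (V)

/-- `M` is (the `A•`-module underlying) a free `A•_σ`-module. -/
def FreeOverCone (σ : Cone V) (M : Type) [AddCommGroup M] [Module (PolyRing V) M] : Prop :=
  ∃ h : Module.IsTorsionBySet (PolyRing V) M (vanishingIdeal V σ.carrier),
    letI := h.module
    Module.Free (coneRing V σ) M

/-! ## Reduction modulo the maximal graded ideal -/

/-- The submodule `m·M`. -/
def mSub (M : Type) [AddCommGroup M] [Module (PolyRing V) M] :
    Submodule (PolyRing V) M := (mId V) • (⊤ : Submodule (PolyRing V) M)

/-- The reduction `M̄ = M/mM`. -/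
abbrev mRed (M : Type) [AddCommGroup M] [Module (PolyRing V) M] : Type := M ⧸ mSub V M

lemma mSub_le_comap {M N : Type} [AddCommGroup M] [Module (PolyRing V) M]
    [AddCommGroup N] [Module (PolyRing V) N] (f : M →ₗ[PolyRing V] N) :
    mSub V M ≤ (mSub V N).comap f := by
  rw [mSub, Submodule.smul_le]
  intro r hr x _
  simp only [Submodule.mem_comap, map_smul]
  exact Submodule.smul_mem_smul hr trivial

/-- The reduced map `M̄ → N̄` induced by an `A•`-linear map. -/
def mRedMap {M N : Type} [AddCommGroup M] [Module (PolyRing V) M]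
    [AddCommGroup N] [Module (PolyRing V) N] (f : M →ₗ[PolyRing V] N) :
    mRed V M →ₗ[PolyRing V] mRed V N :=
  Submodule.mapQ _ _ f (mSub_le_comap V f)

/-- The image in `M̄` of an `ℝ`-subspace of `M` (e.g. of a graded piece). -/
def mRedPiece {M : Type} [AddCommGroup M] [Module (PolyRing V) M] [Module ℝ M]
    [IsScalarTower ℝ (PolyRing V) M] (p : Submodule ℝ M) : Submodule ℝ (mRed V M) :=
  p.map ((mSub V M).mkQ.restrictScalars ℝ)

/-! ## Sheaves of graded `A•`-modules on a fan -/

open scoped Classical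

/-- The zero cone as an element of a fan. -/
def Fan.ozero {V : Type} [AddCommGroup V] [Module ℝ V] (Δ : Fan V) : Δ.cones :=
  ⟨zeroCone V, Δ.zero_mem⟩


variable {V}

/-- A sheaf of graded `A•`-modules on the fan space `Δ`, given (as the fan topology
dictates) by its stalks on the cones together with compatible restriction maps. -/
structure FanSheaf (Δ : Fan V) where
  stalk : Δ.cones → GAMod V
  res : ∀ σ τ : Δ.cones, Cone.IsFaceOf τ.1 σ.1 → GHom (stalk σ) (stalk τ)
  res_self : ∀ (σ : Δ.cones) (h : Cone.IsFaceOf σ.1 σ.1), (res σ σ h).toLin = LinearMap.id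
  res_comp : ∀ (σ τ υ : Δ.cones) (h1 : Cone.IsFaceOf τ.1 σ.1) (h2 : Cone.IsFaceOf υ.1 τ.1)
      (h3 : Cone.IsFaceOf υ.1 σ.1),
      (res τ υ h2).toLin ∘ₗ (res σ τ h1).toLin = (res σ υ h3).toLin

namespace FanSheaf

variable {Δ : Fan V} (F : FanSheaf Δ)

/-- The sections of `F` over a collection `Λ` of cones of `Δ` (e.g. a subfan):
compatible families of elements of the stalks over `Λ`, extended by zero. -/
def secSub (Λ : Set (Cone V)) :
    Submodule (PolyRing V) (∀ σ : Δ.cones, (F.stalk σ).M) where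
  carrier := { s | (∀ σ : Δ.cones, σ.1 ∉ Λ → s σ = 0) ∧
    ∀ (σ τ : Δ.cones), σ.1 ∈ Λ → τ.1 ∈ Λ → ∀ h : Cone.IsFaceOf τ.1 σ.1,
      (F.res σ τ h).toLin (s σ) = s τ }
  add_mem' := by
    rintro a b ⟨ha0, ha⟩ ⟨hb0, hb⟩
    refine ⟨fun σ hσ => by simp [ha0 σ hσ, hb0 σ hσ], fun σ τ hσ hτ h => ?_⟩
    simp [map_add, ha σ τ hσ hτ h, hb σ τ hσ hτ h]
  zero_mem' := ⟨fun _ _ => rfl, fun σ τ _ _ h => by simp⟩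
  smul_mem' := by
    rintro c a ⟨ha0, ha⟩
    refine ⟨fun σ hσ => by simp [ha0 σ hσ], fun σ τ hσ hτ h => ?_⟩
    simp [map_smul, ha σ τ hσ hτ h]

/-- The `A•`-module of sections of `F` over `Λ`. -/
abbrev Sec (Λ : Set (Cone V)) : Type := F.secSub Λ

/-- The global sections `E•(Δ)`. -/
abbrev globalSec : Type := F.Sec Δ.cones

/-- The degree-`q` part of the module of sections. -/
def secDeg (Λ : Set (Cone V)) (q : ℤ) : Submodule ℝ (F.Sec Λ) where
  carrier := { s | ∀ σ : Δ.cones, s.1 σ ∈ (F.stalk σ).deg q }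
  add_mem' := by intro a b ha hb σ; exact add_mem (ha σ) (hb σ)
  zero_mem' := fun σ => zero_mem _
  smul_mem' := by intro c a ha σ; exact Submodule.smul_mem _ c (ha σ)

/-- Restriction of sections to a smaller collection of cones. -/
def resSec (Λ' Λ : Set (Cone V)) (hΛ : Λ ⊆ Λ') : F.Sec Λ' →ₗ[PolyRing V] F.Sec Λ where
  toFun s := ⟨fun σ => if σ.1 ∈ Λ then s.1 σ else 0, by
    classical
    refine ⟨fun σ hσ => by simp [hσ], fun σ τ hσ hτ h => ?_⟩
    simp only [hσ, hτ, if_pos]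
    exact s.2.2 σ τ (hΛ hσ) (hΛ hτ) h⟩
  map_add' a b := by
    apply Subtype.ext; funext σ; by_cases h : σ.1 ∈ Λ <;> simp [h]
  map_smul' c a := by
    apply Subtype.ext; funext σ; by_cases h : σ.1 ∈ Λ <;> simp [h]

/-- A sheaf is flabby if all restrictions from global sections to subfans are surjective. -/
def Flabby : Prop :=
  ∀ Λ : Set (Cone V), ∀ h : Δ.IsSubfan Λ, Function.Surjective (F.resSec Δ.cones Λ h.1)

/-- The boundary fan `∂σ` of a cone of `Δ`, as a set of cones. -/
def bdFan (σ : Δ.cones) : Set (Cone V) := {τ : Cone V | τ.IsProperFaceOf σ.1}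

/-- The restriction map `E•_σ → E•_{∂σ}` from the stalk to the sections over the
boundary fan of `σ`. -/
def bdRes (σ : Δ.cones) : (F.stalk σ).M →ₗ[PolyRing V] F.Sec (bdFan σ) where
  toFun x := ⟨fun τ => if h : Cone.IsProperFaceOf τ.1 σ.1 then (F.res σ τ h.1).toLin x else 0, by
    refine ⟨fun τ hτ => by simp [bdFan] at hτ; simp [hτ], ?_⟩
    intro τ υ hτ hυ h
    simp only [bdFan, Set.mem_setOf_eq] at hτ hυ
    simp only [dif_pos hτ, dif_pos hυ]
    rw [← F.res_comp σ τ υ hτ.1 h hυ.1]; rfl⟩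
  map_add' a b := by
    apply Subtype.ext; funext τ
    by_cases h : Cone.IsProperFaceOf τ.1 σ.1 <;> simp [h]
  map_smul' c a := by
    apply Subtype.ext; funext τ
    by_cases h : Cone.IsProperFaceOf τ.1 σ.1 <;> simp [h]

/-- The reduced restriction map `Ē•_σ → Ē•_{∂σ}` modulo `m`. -/
def bdResRed (σ : Δ.cones) :
    mRed V (F.stalk σ).M →ₗ[PolyRing V] mRed V (F.Sec (bdFan σ)) :=
  mRedMap V (F.bdRes σ)

/-- Condition (N): `E•_o ≅ A•_o = ℝ•`, i.e. the stalk at the zero cone is the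
trivial one-dimensional graded module concentrated in degree `0`. -/
def CondN : Prop :=
  Module.IsTorsionBySet (PolyRing V) (F.stalk Δ.ozero).M (mId V : Set (PolyRing V)) ∧
  Module.finrank ℝ (F.stalk Δ.ozero).M = 1 ∧
  ∀ q : ℤ, q ≠ 0 → (F.stalk Δ.ozero).deg q = ⊥

/-- Condition (PF): each stalk `E•_σ` is a free `A•_σ`-module. -/
def CondPF : Prop := ∀ σ : Δ.cones, FreeOverCone V σ.1 (F.stalk σ).M

/-- Condition (LME): for each nonzero cone `σ`, the restriction `E•_σ → E•_{∂σ}`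
induces, modulo `m`, an isomorphism of graded real vector spaces. -/
def CondLME : Prop :=
  ∀ σ : Δ.cones, σ.1 ≠ zeroCone V → ∀ q : ℤ,
    Set.BijOn (F.bdResRed σ)
      (mRedPiece V ((F.stalk σ).deg q) : Set (mRed V (F.stalk σ).M))
      (mRedPiece V (M := F.Sec (bdFan σ)) (F.secDeg (bdFan σ) q) : Set (mRed V (F.Sec (bdFan σ))))

/-- A minimal extension sheaf on the fan `Δ`. -/
def IsMES : Prop := F.CondN ∧ F.CondPF ∧ F.CondLME

end FanSheaf

/-! ## Gradings via projections -/

/-- A grading described by a family of projections. -/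
structure MESProj {M : Type} [AddCommGroup M] [Module ℝ M] (deg : ℤ → Submodule ℝ M) where
  pr : ℤ → M →ₗ[ℝ] M
  pr_mem : ∀ q x, pr q x ∈ deg q
  pr_same : ∀ q, ∀ x ∈ deg q, pr q x = x
  pr_ne : ∀ p q, p ≠ q → ∀ x ∈ deg q, pr p x = 0
  pr_sum : ∀ x, ∃ T : Finset ℤ, ∀ T', T ⊆ T' → ∑ q ∈ T', pr q x = x

lemma MESProj.internal {M : Type} [AddCommGroup M] [Module ℝ M] {deg : ℤ → Submodule ℝ M}
    (P : MESProj deg) : DirectSum.IsInternal deg := by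
  apply DirectSum.isInternal_submodule_of_iSupIndep_of_iSup_eq_top
  · rw [iSupIndep_iff_finsetSum_eq_zero_imp_eq_zero]
    intro s v hv hv0 i hi
    have h1 : P.pr i (∑ i ∈ s, v i) = v i := by
      rw [map_sum, Finset.sum_eq_single i]
      · exact P.pr_same i _ (hv i hi)
      · intro j hj hji
        exact P.pr_ne i j hji.symm _ (hv j hj)
      · intro h; exact absurd hi h
    rw [← h1, hv0, map_zero]
  · rw [eq_top_iff]
    intro x _
    obtain ⟨T, hT⟩ := P.pr_sum x
    rw [← hT T (Finset.Subset.refl _)]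
    exact Submodule.sum_mem _ fun q _ => Submodule.mem_iSup_of_mem q (P.pr_mem q x)

lemma MESProj.nonempty {M : Type} [AddCommGroup M] [Module ℝ M] {deg : ℤ → Submodule ℝ M}
    (h : DirectSum.IsInternal deg) : Nonempty (MESProj deg) := by
  let e : (DirectSum ℤ fun i => deg i) ≃ₗ[ℝ] M :=
    LinearEquiv.ofBijective (DirectSum.coeLinearMap deg) h
  have he : ∀ q (x : deg q), e.symm (x : M) = DirectSum.lof ℝ ℤ (fun i => deg i) q x := by
    intro q x
    rw [LinearEquiv.symm_apply_eq]
    exact (DirectSum.coeLinearMap_lof deg q x).symm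
  refine ⟨⟨fun q => (deg q).subtype ∘ₗ DirectSum.component ℝ ℤ (fun i => deg i) q ∘ₗ
    e.symm.toLinearMap, ?_, ?_, ?_, ?_⟩⟩
  · intro q x; simp
  · intro q x hx
    have := he q ⟨x, hx⟩
    simp only at this
    simp [this]
  · intro p q hpq x hx
    have := he q ⟨x, hx⟩
    simp only at this
    simp [this, DirectSum.component.of, hpq.symm]
  · intro x
    obtain ⟨y, rfl⟩ := e.surjective x
    refine ⟨y.support, fun T hT => ?_⟩
    simp only [LinearMap.comp_apply, LinearEquiv.coe_coe, LinearEquiv.symm_apply_apply,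
      Submodule.subtype_apply, DirectSum.component]
    have h2 : e y = ∑ i ∈ y.support, (y i : M) := by
      exact DirectSum.coeLinearMap_eq_dfinsuppSum deg y
    rw [h2]
    symm
    apply Finset.sum_subset hT
    intro i _ hi
    simp only [DFinsupp.mem_support_toFun, not_not] at hi
    simp [hi]

/-! ## The grading of `A` and `A_σ` -/

lemma MES_Adeg_even (k : ℕ) : Adeg V (2 * (k : ℤ)) = AdegN V k := by
  apply le_antisymm
  · apply iSup_le; intro j; apply iSup_le; intro hj
    have : k = j := by omega
    rw [this]
  · exact le_iSup₂_of_le k rfl le_rfl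

lemma MES_Adeg_odd (q : ℤ) (h : ∀ k : ℕ, q ≠ 2 * (k : ℤ)) : Adeg V q = ⊥ := by
  rw [eq_bot_iff]
  apply iSup_le; intro j; apply iSup_le; intro hj
  exact absurd hj (h j)

lemma MES_AdegN_mul {i j : ℕ} {a b : PolyRing V} (ha : a ∈ AdegN V i) (hb : b ∈ AdegN V j) :
    a * b ∈ AdegN V (i + j) := by
  intro t x
  have h1 := ha t x
  have h2 := hb t x
  simp only [MulMemClass.coe_mul, Pi.mul_apply, h1, h2]
  ring

lemma MES_Adeg_mul {p q : ℤ} {a b : PolyRing V} (ha : a ∈ Adeg V p) (hb : b ∈ Adeg V q) :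
    a * b ∈ Adeg V (p + q) := by
  by_cases hp : ∃ k : ℕ, p = 2 * (k : ℤ)
  · by_cases hq : ∃ k : ℕ, q = 2 * (k : ℤ)
    · obtain ⟨i, rfl⟩ := hp
      obtain ⟨j, rfl⟩ := hq
      rw [MES_Adeg_even] at ha hb
      have : 2 * (i : ℤ) + 2 * (j : ℤ) = 2 * ((i + j : ℕ) : ℤ) := by push_cast; ring
      rw [this, MES_Adeg_even]
      exact MES_AdegN_mul ha hb
    · push Not at hq
      rw [MES_Adeg_odd q hq, Submodule.mem_bot] at hb
      simp [hb]
  · push Not at hp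
    rw [MES_Adeg_odd p hp, Submodule.mem_bot] at ha
    simp [ha]

lemma MES_one_mem : (1 : PolyRing V) ∈ Adeg V 0 := by
  have := MES_Adeg_even (V := V) 0
  simp only [Nat.cast_zero, mul_zero] at this
  rw [this]
  intro t x
  simp

lemma MES_AdegN_iSup : (⨆ k, AdegN V k) = ⊤ := by
  rw [eq_top_iff]
  rintro ⟨f, hf⟩ -
  induction hf using Algebra.adjoin_induction with
  | mem f hf =>
    apply Submodule.mem_iSup_of_mem 1
    intro t x
    have := (hf : IsLinearMap ℝ f).map_smul t x
    simpa using this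
  | algebraMap r =>
    apply Submodule.mem_iSup_of_mem 0
    intro t x
    simp
  | add f g hf hg h1 h2 => exact add_mem h1 h2
  | mul f g hf hg h1 h2 =>
    have key : ∀ a ∈ (⨆ k, AdegN V k), ∀ b ∈ (⨆ k, AdegN V k), a * b ∈ (⨆ k, AdegN V k) := by
      intro a ha b hb
      induction ha using Submodule.iSup_induction' with
      | mem i a ha =>
        induction hb using Submodule.iSup_induction' with
        | mem j b hb => exact Submodule.mem_iSup_of_mem (i + j) (MES_AdegN_mul ha hb)
        | zero => simp
        | add x y _ _ hx hy => rw [mul_add]; exact add_mem hx hy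
      | zero => simp
      | add x y _ _ hx hy => rw [add_mul]; exact add_mem hx hy
    exact key _ h1 _ h2

lemma MES_Adeg_iSup : (⨆ q, Adeg V q) = ⊤ := by
  rw [eq_top_iff, ← MES_AdegN_iSup]
  apply iSup_le; intro k
  rw [← MES_Adeg_even]
  exact le_iSup (Adeg V) _

lemma MES_coeff_zero (T : Finset ℕ) (c : ℕ → ℝ)
    (h : ∀ t : ℝ, 0 ≤ t → ∑ k ∈ T, t ^ k * c k = 0) : ∀ k ∈ T, c k = 0 := by
  have h0 : (∑ k ∈ T, Polynomial.monomial k (c k) : Polynomial ℝ) = 0 := by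
    apply Polynomial.eq_zero_of_infinite_isRoot
    apply (Set.Ici_infinite (0 : ℝ)).mono
    intro t ht
    have := h t ht
    simp only [Set.mem_ofPred_eq, Polynomial.IsRoot.def, Polynomial.eval_finsetSum,
      Polynomial.eval_monomial]
    rw [← this]
    exact Finset.sum_congr rfl fun k _ => mul_comm _ _
  intro k hk
  have := congrArg (fun p => Polynomial.coeff p k) h0
  simpa [Polynomial.coeff_monomial, hk] using this

lemma MES_cone_smul (σ : Cone V) {x : V} (hx : x ∈ σ.carrier) {t : ℝ} (ht : 0 ≤ t) :
    t • x ∈ σ.carrier := by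
  obtain ⟨s, hs⟩ := σ.isPoly
  rw [hs] at hx ⊢
  obtain ⟨c, hc, rfl⟩ := hx
  refine ⟨fun v => t * c v, fun v hv => mul_nonneg ht (hc v hv), ?_⟩
  rw [Finset.smul_sum]
  exact Finset.sum_congr rfl fun v _ => by rw [smul_smul]

lemma MES_zero_mem (σ : Cone V) : (0 : V) ∈ σ.carrier := by
  obtain ⟨s, hs⟩ := σ.isPoly
  rw [hs]
  exact ⟨0, by simp, by simp⟩

lemma MES_mem_vanishing {s : Set V} {f : PolyRing V} :
    f ∈ vanishingIdeal V s ↔ ∀ x ∈ s, (f : V → ℝ) x = 0 := by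
  rw [vanishingIdeal, RingHom.mem_ker]
  constructor
  · intro h x hx
    exact congrFun h ⟨x, hx⟩
  · intro h
    funext x
    exact h x.1 x.2

lemma MES_mem_mId {f : PolyRing V} : f ∈ mId V ↔ (f : V → ℝ) 0 = 0 := by
  rw [mId, RingHom.mem_ker]; rfl

/-- The quotient map as a real linear map. -/
def MESmk (σ : Cone V) : PolyRing V →ₗ[ℝ] coneRing V σ :=
  (Ideal.Quotient.mkₐ ℝ (vanishingIdeal V σ.carrier)).toLinearMap

/-- Grading of the cone ring. -/
def MESRdeg (σ : Cone V) (q : ℤ) : Submodule ℝ (coneRing V σ) := (Adeg V q).map (MESmk σ)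

lemma MESmk_eq_zero {σ : Cone V} {a : PolyRing V} :
    MESmk σ a = 0 ↔ ∀ x ∈ σ.carrier, (a : V → ℝ) x = 0 := by
  rw [← MES_mem_vanishing]
  exact Ideal.Quotient.eq_zero_iff_mem

lemma MESRdeg_internal (σ : Cone V) : DirectSum.IsInternal (MESRdeg σ) := by
  apply DirectSum.isInternal_submodule_of_iSupIndep_of_iSup_eq_top
  · rw [iSupIndep_iff_finsetSum_eq_zero_imp_eq_zero]
    intro s v hv hv0
    have hex : ∀ q, ∃ a : PolyRing V, q ∈ s → (a ∈ Adeg V q ∧ MESmk σ a = v q) := by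
      intro q
      by_cases hq : q ∈ s
      · obtain ⟨a, ha⟩ := hv q hq
        exact ⟨a, fun _ => ha⟩
      · exact ⟨0, fun h => absurd h hq⟩
    choose a ha using hex
    have hsum : ∀ x ∈ σ.carrier, ∑ q ∈ s, (a q : V → ℝ) x = 0 := by
      have h1 : MESmk σ (∑ q ∈ s, a q) = 0 := by
        rw [map_sum, ← hv0]
        exact Finset.sum_congr rfl fun q hq => (ha q hq).2
      rw [MESmk_eq_zero] at h1
      intro x hx
      have := h1 x hx
      simpa using this
    -- reduce to even nonnegative degrees
    let T : Finset ℕ := s.preimage (fun k : ℕ => 2 * (k : ℤ))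
      (by intro i _ j _ h; simpa using h)
    have hTm : ∀ k : ℕ, k ∈ T ↔ 2 * (k : ℤ) ∈ s := fun k => Finset.mem_preimage
    have hT : ∀ x, ∑ q ∈ s, (a q : V → ℝ) x = ∑ k ∈ T, (a (2 * (k : ℤ)) : V → ℝ) x := by
      intro x
      symm
      refine Finset.sum_preimage (fun k : ℕ => 2 * (k : ℤ)) s _ (fun q => (a q : V → ℝ) x) ?_
      intro q hq hq'
      have h1 := (ha q hq).1
      rw [MES_Adeg_odd q (by intro k hk; exact hq' ⟨k, hk.symm⟩), Submodule.mem_bot] at h1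
      simp [h1]
    intro q hq
    rw [← (ha q hq).2, MESmk_eq_zero]
    intro x hx
    by_cases hk : ∃ k : ℕ, q = 2 * (k : ℤ)
    · obtain ⟨k, rfl⟩ := hk
      refine MES_coeff_zero T (fun k => (a (2 * (k : ℤ)) : V → ℝ) x) ?_ k ((hTm k).2 hq)
      intro t ht
      rw [← hsum (t • x) (MES_cone_smul σ hx ht), hT]
      apply Finset.sum_congr rfl
      intro k hk
      have h1 := (ha _ ((hTm k).1 hk)).1
      rw [MES_Adeg_even] at h1
      exact (h1 t x).symm
    · push Not at hk
      have h1 := (ha q hq).1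
      rw [MES_Adeg_odd q hk, Submodule.mem_bot] at h1
      simp [h1]
  · have : (⨆ q, MESRdeg σ q) = (⨆ q, Adeg V q).map (MESmk σ) := by
      rw [Submodule.map_iSup]; rfl
    rw [this, MES_Adeg_iSup, Submodule.map_top, LinearMap.range_eq_top]
    exact Ideal.Quotient.mk_surjective

/-! ## Free graded modules over the cone ring -/

lemma MESmk_smul (σ : Cone V) (a b : PolyRing V) : a • MESmk σ b = MESmk σ (a * b) := rfl

lemma MESRdeg_smul (σ : Cone V) {p q : ℤ} {a : PolyRing V} (ha : a ∈ Adeg V p)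
    {r : coneRing V σ} (hr : r ∈ MESRdeg σ q) : a • r ∈ MESRdeg σ (p + q) := by
  obtain ⟨b, hb, rfl⟩ := hr
  exact ⟨a * b, MES_Adeg_mul ha hb, (MESmk_smul σ a b).symm⟩

/-- Graded pieces of the free module with generators in degrees `d`. -/
def MESfdeg (σ : Cone V) {B : Type} (d : B → ℤ) (q : ℤ) : Submodule ℝ (B →₀ coneRing V σ) where
  carrier := {f | ∀ β, f β ∈ MESRdeg σ (q - d β)}
  add_mem' := by intro f g hf hg β; exact add_mem (hf β) (hg β)
  zero_mem' := fun β => zero_mem _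
  smul_mem' := by intro c f hf β; exact Submodule.smul_mem _ c (hf β)

lemma MESfdeg_internal (σ : Cone V) {B : Type} (d : B → ℤ) :
    DirectSum.IsInternal (MESfdeg σ d) := by
  obtain ⟨P⟩ := MESProj.nonempty (MESRdeg_internal σ)
  let pr : ℤ → (B →₀ coneRing V σ) →ₗ[ℝ] (B →₀ coneRing V σ) := fun q =>
    { toFun := fun f => Finsupp.onFinset f.support (fun β => P.pr (q - d β) (f β))
        (by intro β h; rw [Finsupp.mem_support_iff]; intro h0; apply h; rw [h0, map_zero])
      map_add' := by intro f g; ext β; simp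
      map_smul' := by intro c f; ext β; simp }
  have hpr : ∀ q f β, pr q f β = P.pr (q - d β) (f β) := fun q f β => rfl
  refine MESProj.internal ⟨pr, ?_, ?_, ?_, ?_⟩
  · intro q f β
    rw [hpr]; exact P.pr_mem _ _
  · intro q f hf
    ext β
    rw [hpr]; exact P.pr_same _ _ (hf β)
  · intro p q hpq f hf
    ext β
    rw [hpr]; exact P.pr_ne _ _ (by omega) _ (hf β)
  · intro f
    choose T hT using P.pr_sum
    refine ⟨f.support.biUnion fun β => (T (f β)).image (fun q => q + d β), fun T' hT' => ?_⟩
    ext β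
    rw [Finsupp.finsetSum_apply]
    simp only [hpr]
    by_cases hβ : f β = 0
    · simp [hβ]
    · have h1 : ∑ q ∈ T', P.pr (q - d β) (f β) =
          ∑ q ∈ T'.image (fun q => q - d β), P.pr q (f β) := by
        rw [Finset.sum_image]
        intro x _ y _ h
        simpa using h
      rw [h1]
      apply hT
      intro q hq
      rw [Finset.mem_image]
      refine ⟨q + d β, hT' ?_, by ring⟩
      rw [Finset.mem_biUnion]
      exact ⟨β, Finsupp.mem_support_iff.2 hβ, Finset.mem_image_of_mem _ hq⟩

/-- The free graded module. -/
def MESfree (σ : Cone V) {B : Type} (d : B → ℤ) : GAMod V where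
  M := B →₀ coneRing V σ
  deg := MESfdeg σ d
  internal := MESfdeg_internal σ d
  smul_deg := by
    intro p q a ha f hf β
    have := MESRdeg_smul σ ha (hf β)
    rw [add_sub_assoc]
    exact this

lemma MES_torsion (σ : Cone V) (B : Type) :
    Module.IsTorsionBySet (PolyRing V) (B →₀ coneRing V σ) (vanishingIdeal V σ.carrier) := by
  rintro f ⟨a, ha⟩
  ext β
  obtain ⟨b, hb⟩ := Ideal.Quotient.mk_surjective (f β)
  change a • f β = 0
  rw [← hb]
  change Ideal.Quotient.mk _ (a * b) = 0
  rw [Ideal.Quotient.eq_zero_iff_mem]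
  exact Ideal.mul_mem_right _ _ ha

lemma MES_freeOver (σ : Cone V) {B : Type} (d : B → ℤ) :
    FreeOverCone V σ (MESfree σ d).M := by
  have ht := MES_torsion σ B
  refine ⟨ht, ?_⟩
  have key : ∀ (inst : Module (coneRing V σ) (B →₀ coneRing V σ)),
      (∀ (a : PolyRing V) (f : B →₀ coneRing V σ),
        inst.smul (Ideal.Quotient.mk _ a) f = a • f) →
      @Module.Free (coneRing V σ) (B →₀ coneRing V σ) _ _ inst := by
    intro inst h
    have : inst = Finsupp.module B (coneRing V σ) := by
      apply Module.ext'
      intro r f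
      obtain ⟨a, rfl⟩ := Ideal.Quotient.mk_surjective r
      exact h a f
    subst this
    infer_instance
  exact key ht.module (fun a f => rfl)

/-- Existence of the minimal free cover of a graded module over the cone ring. -/
lemma MES_core (σ : Cone V) (N : GAMod V)
    (ht : Module.IsTorsionBySet (PolyRing V) N.M (vanishingIdeal V σ.carrier)) :
    ∃ (G : GAMod V) (φ : GHom G N), FreeOverCone V σ G.M ∧
      ∀ q, Set.BijOn (mRedMap V φ.toLin) (mRedPiece V (G.deg q)) (mRedPiece V (N.deg q)) := by
  obtain ⟨P⟩ := MESProj.nonempty N.internal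
  -- choose homogeneous elements forming a basis of the reduction
  let mkN : N.M →ₗ[ℝ] mRed V N.M := (mSub V N.M).mkQ.restrictScalars ℝ
  let v : {x : N.M × ℤ // x.1 ∈ N.deg x.2} → mRed V N.M := fun x => mkN x.1.1
  obtain ⟨B, a, -, hspan, hli⟩ := exists_linearIndependent' (K := ℝ) v
  let b : B → N.M := fun β => (a β).1.1
  let d : B → ℤ := fun β => (a β).1.2
  have hb : ∀ β, b β ∈ N.deg (d β) := fun β => (a β).2
  have htop : Submodule.span ℝ (Set.range (mkN ∘ b)) = ⊤ := by
    have : mkN ∘ b = v ∘ a := rfl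
    rw [this, hspan, eq_top_iff]
    intro y _
    obtain ⟨x, rfl⟩ := Submodule.mkQ_surjective _ y
    obtain ⟨T, hT⟩ := P.pr_sum x
    rw [← hT T (Finset.Subset.refl _), map_sum]
    exact Submodule.sum_mem _ fun q _ => Submodule.subset_span ⟨⟨(P.pr q x, q), P.pr_mem q x⟩, rfl⟩
  let _ : Module (coneRing V σ) N.M := ht.module
  have _ : IsScalarTower (PolyRing V) (coneRing V σ) N.M := ht.isScalarTower
  have hmk : ∀ (p : PolyRing V) (x : N.M), MESmk σ p • x = p • x := fun p x => rfl
  let φ : (B →₀ coneRing V σ) →ₗ[PolyRing V] N.M :=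
    (Finsupp.linearCombination (coneRing V σ) b).restrictScalars (PolyRing V)
  have hφ : ∀ f, φ f = f.sum fun β r => r • b β := fun f => rfl
  have hφs : ∀ β p, φ (Finsupp.single β (MESmk σ p)) = p • b β := by
    intro β p
    rw [hφ, Finsupp.sum_single_index (by simp), hmk]
  have hdeg : ∀ q, ∀ f ∈ MESfdeg σ d q, φ f ∈ N.deg q := by
    intro q f hf
    rw [hφ]
    apply Submodule.sum_mem
    intro β _
    obtain ⟨p, hp, hpf⟩ := hf β
    have h1 := N.smul_deg _ _ p hp _ (hb β)
    rw [sub_add_cancel] at h1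
    rw [← hpf]
    exact h1
  let L : (B →₀ ℝ) →ₗ[ℝ] (B →₀ coneRing V σ) :=
    Finsupp.linearCombination ℝ (fun β => Finsupp.single β (MESmk σ 1))
  have hL : ∀ c, φ (L c) = Finsupp.linearCombination ℝ b c := by
    intro c
    have h1 : (φ.restrictScalars ℝ) ∘ₗ L = Finsupp.linearCombination ℝ b := by
      ext β
      simp only [L, LinearMap.comp_apply, Finsupp.lsingle_apply, Finsupp.linearCombination_single,
        one_smul, LinearMap.restrictScalars_apply, hφs]
    exact LinearMap.congr_fun h1 c
  have hLdeg : ∀ q c, (∀ β, c β ≠ 0 → d β = q) → L c ∈ MESfdeg σ d q := by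
    intro q c hc
    rw [Finsupp.linearCombination_apply]
    apply Submodule.sum_mem
    intro β hβ
    apply Submodule.smul_mem
    intro γ
    rw [Finsupp.single_apply]
    split_ifs with h
    · subst h
      rw [hc β (Finsupp.mem_support_iff.1 hβ), sub_self]
      exact ⟨1, MES_one_mem, rfl⟩
    · exact zero_mem _
  have hmod : ∀ f : B →₀ coneRing V σ, ∃ c : B →₀ ℝ, f - L c ∈ mSub V (B →₀ coneRing V σ) := by
    intro f
    induction f using Finsupp.induction_linear with
    | zero => exact ⟨0, by simp⟩
    | add f g hf hg =>
      obtain ⟨c, hc⟩ := hf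
      obtain ⟨c', hc'⟩ := hg
      refine ⟨c + c', ?_⟩
      have := add_mem hc hc'
      rw [map_add]
      convert this using 1
      abel
    | single β r =>
      obtain ⟨p, rfl⟩ := Ideal.Quotient.mk_surjective r
      refine ⟨Finsupp.single β ((p : V → ℝ) 0), ?_⟩
      simp only [L, Finsupp.linearCombination_single]
      have h1 : p - algebraMap ℝ (PolyRing V) ((p : V → ℝ) 0) ∈ mId V := by
        rw [MES_mem_mId]; simp
      have h2 := Submodule.smul_mem_smul h1
        (Submodule.mem_top : Finsupp.single β (MESmk σ 1) ∈
          (⊤ : Submodule (PolyRing V) (B →₀ coneRing V σ)))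
      rw [sub_smul, algebraMap_smul] at h2
      have h3 : p • Finsupp.single β (MESmk σ 1) =
          Finsupp.single β (Ideal.Quotient.mk (vanishingIdeal V σ.carrier) p) := by
        rw [Finsupp.smul_single, MESmk_smul, mul_one]; rfl
      rw [h3] at h2
      exact h2
  -- the projections preserve `m N`
  have hpr : ∀ q, ∀ x ∈ mSub V N.M, P.pr q x ∈ mSub V N.M := by
    intro q x hx
    induction hx using Submodule.smul_induction_on' with
    | smul r hr n hn =>
      have hr' : r ∈ ⨆ k, AdegN V k := by rw [MES_AdegN_iSup]; trivial
      rw [Submodule.mem_iSup_iff_exists_finsupp] at hr'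
      obtain ⟨g, hg, hgs⟩ := hr'
      have hgm : ∀ k, g k ∈ mId V := by
        have hpos : ∀ k, k ≠ 0 → g k ∈ mId V := by
          intro k hk
          rw [MES_mem_mId]
          have := hg k 0 0
          simpa [hk] using this
        intro k
        by_cases hk : k = 0
        · subst hk
          by_cases h0 : 0 ∈ g.support
          · have h1 : g 0 = r - ∑ k ∈ g.support.erase 0, g k := by
              rw [← hgs, Finsupp.sum, ← Finset.add_sum_erase _ _ h0]; abel
            rw [h1]
            exact sub_mem hr (Submodule.sum_mem _ fun k hk => hpos k (Finset.ne_of_mem_erase hk))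
          · rw [Finsupp.notMem_support_iff.1 h0]; exact zero_mem _
        · exact hpos k hk
      obtain ⟨T, hT⟩ := P.pr_sum n
      rw [← hT T (Finset.Subset.refl _), ← hgs, Finsupp.sum, Finset.sum_smul, map_sum]
      apply Submodule.sum_mem
      intro k _
      rw [Finset.smul_sum, map_sum]
      apply Submodule.sum_mem
      intro j _
      have h1 : g k • P.pr j n ∈ N.deg (2 * (k : ℤ) + j) :=
        N.smul_deg _ _ _ (by rw [MES_Adeg_even]; exact hg k) _ (P.pr_mem j n)
      by_cases hq : q = 2 * (k : ℤ) + j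
      · subst hq
        rw [P.pr_same _ _ h1]
        exact Submodule.smul_mem_smul (hgm k) trivial
      · rw [P.pr_ne _ _ hq _ h1]; exact zero_mem _
    | add x _ y _ hx hy => rw [map_add]; exact add_mem hx hy
  refine ⟨MESfree σ d, ⟨φ, hdeg⟩, MES_freeOver σ d, fun q => ⟨?_, ?_, ?_⟩⟩
  · rintro _ ⟨f, hf, rfl⟩
    exact ⟨φ f, hdeg q f hf, rfl⟩
  · apply Function.Injective.injOn
    rw [injective_iff_map_eq_zero]
    intro y hy
    obtain ⟨f', rfl⟩ := Submodule.mkQ_surjective _ y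
    let f : B →₀ coneRing V σ := f'
    have hy' : φ f ∈ mSub V N.M := (Submodule.Quotient.mk_eq_zero _).1 hy
    obtain ⟨c, hc⟩ := hmod f
    have h1 : φ (f - L c) ∈ mSub V N.M := mSub_le_comap V φ hc
    rw [map_sub, hL] at h1
    have h2 : Finsupp.linearCombination ℝ b c ∈ mSub V N.M := by
      have := sub_mem hy' h1
      simpa using this
    have h3 : Finsupp.linearCombination ℝ (v ∘ a) c = 0 := by
      have h4 : mkN (Finsupp.linearCombination ℝ b c) = 0 :=
        (Submodule.Quotient.mk_eq_zero _).2 h2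
      rw [Finsupp.apply_linearCombination] at h4
      exact h4
    have h5 : c = 0 := (linearIndependent_iff.1 hli) c h3
    rw [h5, map_zero, sub_zero] at hc
    exact (Submodule.Quotient.mk_eq_zero _).2 hc
  · rintro _ ⟨y, hy, rfl⟩
    have hy1 : mkN y ∈ Submodule.span ℝ (Set.range (mkN ∘ b)) := by rw [htop]; trivial
    rw [Finsupp.mem_span_range_iff_exists_finsupp] at hy1
    obtain ⟨c, hc⟩ := hy1
    have h1 : y - Finsupp.linearCombination ℝ b c ∈ mSub V N.M := by
      rw [← Submodule.Quotient.mk_eq_zero]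
      change mkN (y - Finsupp.linearCombination ℝ b c) = 0
      rw [map_sub, Finsupp.apply_linearCombination, Finsupp.linearCombination_apply, hc, sub_self]
    have h2 := hpr q _ h1
    rw [map_sub, P.pr_same q y hy] at h2
    let c' : B →₀ ℝ := c.filter (fun β => d β = q)
    have h3 : P.pr q (Finsupp.linearCombination ℝ b c) = Finsupp.linearCombination ℝ b c' := by
      rw [Finsupp.linearCombination_apply, Finsupp.linearCombination_apply, Finsupp.sum,
        Finsupp.sum, map_sum, Finsupp.support_filter, Finset.sum_filter]
      apply Finset.sum_congr rfl
      intro β _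
      split_ifs with h
      · have h4 : c' β = c β := Finsupp.filter_apply_pos (fun β => d β = q) c h
        rw [h4]
        exact P.pr_same _ _ (Submodule.smul_mem _ _ (h ▸ hb β))
      · exact P.pr_ne _ _ (Ne.symm h) _ (Submodule.smul_mem _ _ (hb β))
    rw [h3] at h2
    refine ⟨Submodule.mkQ _ (L c'), ⟨L c', hLdeg q c' ?_, rfl⟩, ?_⟩
    · intro β hβ
      by_contra h
      exact hβ (Finsupp.filter_apply_neg (fun β => d β = q) c h)
    · change mkN (φ (L c')) = mkN y
      rw [hL]
      symm
      exact (Submodule.Quotient.eq _).2 h2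

/-! ## Sheaves over an indexed family of cones -/

/-- A sheaf of graded modules on an indexed family of cones. -/
structure MESPS {I : Type} (c : I → Cone V) where
  stalk : I → GAMod V
  res : ∀ i j : I, Cone.IsFaceOf (c j) (c i) → GHom (stalk i) (stalk j)
  res_self : ∀ (i : I) (h : Cone.IsFaceOf (c i) (c i)), (res i i h).toLin = LinearMap.id
  res_comp : ∀ (i j k : I) (h1 : Cone.IsFaceOf (c j) (c i)) (h2 : Cone.IsFaceOf (c k) (c j))
      (h3 : Cone.IsFaceOf (c k) (c i)),
      (res j k h2).toLin ∘ₗ (res i j h1).toLin = (res i k h3).toLin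

namespace MESPS

variable {I : Type} {c : I → Cone V} (F : MESPS c)

/-- Sections. -/
def secSub (Λ : Set (Cone V)) : Submodule (PolyRing V) (∀ i : I, (F.stalk i).M) where
  carrier := { s | (∀ i : I, c i ∉ Λ → s i = 0) ∧
    ∀ (i j : I), c i ∈ Λ → c j ∈ Λ → ∀ h : Cone.IsFaceOf (c j) (c i),
      (F.res i j h).toLin (s i) = s j }
  add_mem' := by
    rintro a b ⟨ha0, ha⟩ ⟨hb0, hb⟩
    refine ⟨fun σ hσ => by simp [ha0 σ hσ, hb0 σ hσ], fun σ τ hσ hτ h => ?_⟩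
    simp [map_add, ha σ τ hσ hτ h, hb σ τ hσ hτ h]
  zero_mem' := ⟨fun _ _ => rfl, fun σ τ _ _ h => by simp⟩
  smul_mem' := by
    rintro c a ⟨ha0, ha⟩
    refine ⟨fun σ hσ => by simp [ha0 σ hσ], fun σ τ hσ hτ h => ?_⟩
    simp [map_smul, ha σ τ hσ hτ h]

/-- Graded pieces of sections. -/
def secDeg (Λ : Set (Cone V)) (q : ℤ) : Submodule ℝ (F.secSub Λ) where
  carrier := { s | ∀ i : I, s.1 i ∈ (F.stalk i).deg q }
  add_mem' := by intro a b ha hb σ; exact add_mem (ha σ) (hb σ)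
  zero_mem' := fun σ => zero_mem _
  smul_mem' := by intro c a ha σ; exact Submodule.smul_mem _ c (ha σ)

/-- The proper faces of a cone. -/
abbrev bd (σ : Cone V) : Set (Cone V) := {τ : Cone V | τ.IsProperFaceOf σ}

/-- Restriction to the boundary. -/
def bdRes (i : I) : (F.stalk i).M →ₗ[PolyRing V] F.secSub (bd (c i)) where
  toFun x := ⟨fun j => if h : Cone.IsProperFaceOf (c j) (c i) then (F.res i j h.1).toLin x else 0,
    by
    refine ⟨fun τ hτ => dif_neg hτ, ?_⟩
    intro τ υ hτ hυ h
    have hτ' : Cone.IsProperFaceOf (c τ) (c i) := hτ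
    have hυ' : Cone.IsProperFaceOf (c υ) (c i) := hυ
    simp only [dif_pos hτ', dif_pos hυ']
    rw [← F.res_comp i τ υ hτ'.1 h hυ'.1]; rfl⟩
  map_add' a b := by
    apply Subtype.ext; funext τ
    by_cases h : Cone.IsProperFaceOf (c τ) (c i) <;> simp [h]
  map_smul' r a := by
    apply Subtype.ext; funext τ
    by_cases h : Cone.IsProperFaceOf (c τ) (c i) <;> simp [h]

/-- Local minimality at an index. -/
def LMEat (i : I) : Prop :=
  ∀ q : ℤ, Set.BijOn (mRedMap V (F.bdRes i))
      (mRedPiece V ((F.stalk i).deg q) : Set (mRed V (F.stalk i).M))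
      (mRedPiece V (M := F.secSub (bd (c i))) (F.secDeg (bd (c i)) q) :
        Set (mRed V (F.secSub (bd (c i)))))

/-- Normalization at an index. -/
def Nat' (i : I) : Prop :=
  Module.IsTorsionBySet (PolyRing V) (F.stalk i).M (mId V : Set (PolyRing V)) ∧
  Module.finrank ℝ (F.stalk i).M = 1 ∧
  ∀ q : ℤ, q ≠ 0 → (F.stalk i).deg q = ⊥

/-- All conditions. -/
def Good : Prop :=
  (∀ i, c i = zeroCone V → F.Nat' i) ∧ (∀ i, FreeOverCone V (c i) (F.stalk i).M) ∧
    ∀ i, c i ≠ zeroCone V → F.LMEat i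

/-- The module of sections is graded. -/
lemma sec_internal [Finite I] (Λ : Set (Cone V)) : DirectSum.IsInternal (F.secDeg Λ) := by
  have hP : ∀ i, Nonempty (MESProj (F.stalk i).deg) := fun i =>
    MESProj.nonempty (F.stalk i).internal
  let P : ∀ i, MESProj (F.stalk i).deg := fun i => (hP i).some
  have hcomm : ∀ i j h q x, (F.res i j h).toLin ((P i).pr q x) =
      (P j).pr q ((F.res i j h).toLin x) := by
    intro i j h q x
    obtain ⟨T, hT⟩ := (P i).pr_sum x
    have hT' := hT (insert q T) (Finset.subset_insert _ _)
    conv_rhs => rw [← hT', map_sum, map_sum]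
    rw [Finset.sum_eq_single q]
    · rw [(P j).pr_same]
      exact (F.res i j h).deg_mem q _ ((P i).pr_mem q x)
    · intro p _ hpq
      exact (P j).pr_ne q p hpq.symm _ ((F.res i j h).deg_mem p _ ((P i).pr_mem p x))
    · intro h; simp at h
  let pr : ℤ → (F.secSub Λ) →ₗ[ℝ] (F.secSub Λ) := fun q =>
    { toFun := fun s => ⟨fun i => (P i).pr q (s.1 i), by
        refine ⟨fun i hi => by simp only [s.2.1 i hi, map_zero], fun i j hi hj h => ?_⟩
        rw [hcomm, s.2.2 i j hi hj h]⟩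
      map_add' := by intro s t; apply Subtype.ext; funext i; simp
      map_smul' := by intro r s; apply Subtype.ext; funext i; simp }
  have hpr : ∀ q s i, (pr q s).1 i = (P i).pr q (s.1 i) := fun q s i => rfl
  refine MESProj.internal ⟨pr, ?_, ?_, ?_, ?_⟩
  · intro q s i
    exact (P i).pr_mem _ _
  · intro q s hs
    apply Subtype.ext; funext i
    exact (P i).pr_same _ _ (hs i)
  · intro p q hpq s hs
    apply Subtype.ext; funext i
    exact (P i).pr_ne _ _ hpq _ (hs i)
  · intro s
    have := Fintype.ofFinite I
    choose T hT using fun i => (P i).pr_sum (s.1 i)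
    refine ⟨Finset.univ.biUnion T, fun T' hT' => ?_⟩
    apply Subtype.ext; funext i
    rw [Submodule.coe_sum, Finset.sum_apply]
    simp only [hpr]
    exact hT i T' ((Finset.subset_biUnion_of_mem T (Finset.mem_univ i)).trans hT')

/-- The graded module of sections. -/
def secG [Finite I] (Λ : Set (Cone V)) : GAMod V where
  M := F.secSub Λ
  deg := F.secDeg Λ
  internal := F.sec_internal Λ
  smul_deg := by
    intro p q a ha s hs i
    exact (F.stalk i).smul_deg p q a ha _ (hs i)

/-- Pullback along a map of index types. -/
def pull {J : Type} (u : J → I) : MESPS (fun j => c (u j)) where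
  stalk j := F.stalk (u j)
  res i j h := F.res (u i) (u j) h
  res_self i h := F.res_self (u i) h
  res_comp i j k h1 h2 h3 := F.res_comp (u i) (u j) (u k) h1 h2 h3

/-- Pullback of sections. -/
def pullSec {J : Type} (u : J → I) (Λ : Set (Cone V)) :
    F.secSub Λ →ₗ[PolyRing V] (F.pull u).secSub Λ where
  toFun s := ⟨fun j => s.1 (u j), fun j hj => s.2.1 (u j) hj,
    fun i j hi hj h => s.2.2 (u i) (u j) hi hj h⟩
  map_add' _ _ := rfl
  map_smul' _ _ := rfl

lemma pullSec_bij {J : Type} (u : J → I) (hu : Function.Injective u) (Λ : Set (Cone V))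
    (hΛ : ∀ i, c i ∈ Λ → i ∈ Set.range u) : Function.Bijective (F.pullSec u Λ) := by
  constructor
  · intro s t hst
    apply Subtype.ext; funext i
    by_cases hi : c i ∈ Λ
    · obtain ⟨j, rfl⟩ := hΛ i hi
      exact congrFun (congrArg Subtype.val hst) j
    · rw [s.2.1 i hi, t.2.1 i hi]
  · intro t
    have hex : ∀ i, ∃ x : (F.stalk i).M, (∀ j (h : u j = i), x = h ▸ t.1 j) ∧
        (i ∉ Set.range u → x = 0) := by
      intro i
      by_cases hi : i ∈ Set.range u
      · obtain ⟨j, rfl⟩ := hi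
        refine ⟨t.1 j, ?_, fun h => absurd ⟨j, rfl⟩ h⟩
        intro j' h
        obtain rfl := hu h
        rfl
      · exact ⟨0, fun j h => absurd ⟨j, h⟩ hi, fun _ => rfl⟩
    choose s hs1 hs2 using hex
    have hs : ∀ j, s (u j) = t.1 j := fun j => hs1 (u j) j rfl
    refine ⟨⟨s, ?_, ?_⟩, ?_⟩
    · intro i hi
      by_cases h : i ∈ Set.range u
      · obtain ⟨j, rfl⟩ := h
        rw [hs]
        exact t.2.1 j hi
      · exact hs2 i h
    · intro i k hi hk h
      obtain ⟨i, rfl⟩ := hΛ i hi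
      obtain ⟨k, rfl⟩ := hΛ k hk
      rw [hs, hs]
      exact t.2.2 i k hi hk h
    · apply Subtype.ext; funext j
      exact hs j

lemma pullSec_deg {J : Type} (u : J → I) (Λ : Set (Cone V))
    (hΛ : ∀ i, c i ∈ Λ → i ∈ Set.range u) (q : ℤ) (s : F.secSub Λ) :
    F.pullSec u Λ s ∈ (F.pull u).secDeg Λ q ↔ s ∈ F.secDeg Λ q := by
  constructor
  · intro h i
    by_cases hi : c i ∈ Λ
    · obtain ⟨j, rfl⟩ := hΛ i hi
      exact h j
    · rw [s.2.1 i hi]; exact zero_mem _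
  · intro h j
    exact h (u j)

end MESPS

/-- Transport of the minimality condition along an isomorphism of the target. -/
lemma MES_transport {M N N' : Type} [AddCommGroup M] [Module (PolyRing V) M]
    [Module ℝ M] [IsScalarTower ℝ (PolyRing V) M]
    [AddCommGroup N] [Module (PolyRing V) N]
    [Module ℝ N] [IsScalarTower ℝ (PolyRing V) N]
    [AddCommGroup N'] [Module (PolyRing V) N']
    [Module ℝ N'] [IsScalarTower ℝ (PolyRing V) N']
    (f : M →ₗ[PolyRing V] N) (p : N →ₗ[PolyRing V] N') (hp : Function.Bijective p)
    (f' : M →ₗ[PolyRing V] N') (hf : ∀ x, p (f x) = f' x)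
    (DM : Submodule ℝ M) (DN : Submodule ℝ N) (DN' : Submodule ℝ N')
    (hD : ∀ x, p x ∈ DN' ↔ x ∈ DN) :
    Set.BijOn (mRedMap V f) (mRedPiece V DM) (mRedPiece V DN) ↔
      Set.BijOn (mRedMap V f') (mRedPiece V DM) (mRedPiece V DN') := by
  let e : N ≃ₗ[PolyRing V] N' := LinearEquiv.ofBijective p hp
  have hinj : Function.Injective (mRedMap V p) := by
    rw [injective_iff_map_eq_zero]
    intro y hy
    obtain ⟨x, rfl⟩ := Submodule.mkQ_surjective _ y
    have h1 : p x ∈ mSub V N' := (Submodule.Quotient.mk_eq_zero _).1 hy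
    have h2 : e.symm (p x) ∈ mSub V N := mSub_le_comap V e.symm.toLinearMap h1
    have h3 : e.symm (p x) = x := e.symm_apply_apply x
    rw [h3] at h2
    exact (Submodule.Quotient.mk_eq_zero _).2 h2
  have himg : mRedMap V p '' (mRedPiece V DN : Set (mRed V N)) = mRedPiece V DN' := by
    ext y
    constructor
    · rintro ⟨_, ⟨x, hx, rfl⟩, rfl⟩
      exact ⟨p x, (hD x).2 hx, rfl⟩
    · rintro ⟨x', hx', rfl⟩
      obtain ⟨x, rfl⟩ := hp.2 x'
      exact ⟨_, ⟨x, (hD x).1 hx', rfl⟩, rfl⟩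
  have hcomp : ⇑(mRedMap V f') = mRedMap V p ∘ mRedMap V f := by
    funext y
    obtain ⟨x, rfl⟩ := Submodule.mkQ_surjective _ y
    change Submodule.mkQ _ (f' x) = Submodule.mkQ _ (p (f x))
    rw [hf]
  have hb : Set.BijOn (mRedMap V p) (mRedPiece V DN) (mRedPiece V DN') := by
    rw [← himg]
    exact hinj.injOn.bijOn_image
  rw [hcomp]
  constructor
  · intro h; exact hb.comp h
  · intro h
    refine ⟨?_, fun x hx y hy hxy => h.2.1 hx hy (congrArg (mRedMap V p) hxy), ?_⟩
    · intro x hx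
      have h1 := h.1 hx
      rw [← himg] at h1
      obtain ⟨y, hy, hyx⟩ := h1
      rw [← hinj hyx]
      exact hy
    · intro y hy
      obtain ⟨x, hx, hxy⟩ := h.2.2 (hb.1 hy)
      exact ⟨x, hx, hinj hxy⟩

lemma MESPS.LMEat_pull {I J : Type} {c : I → Cone V} (F : MESPS c) (u : J → I)
    (hu : Function.Injective u) (j : J)
    (hΛ : ∀ i, Cone.IsProperFaceOf (c i) (c (u j)) → i ∈ Set.range u) :
    F.LMEat (u j) ↔ (F.pull u).LMEat j := by
  apply forall_congr'
  intro q
  exact MES_transport (F.bdRes (u j)) (F.pullSec u (MESPS.bd (c (u j))))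
    (F.pullSec_bij u hu _ hΛ) ((F.pull u).bdRes j) (fun x => rfl) _ _ _
    (fun x => F.pullSec_deg u _ hΛ q x)

lemma MESPS.LMEat_of {I J : Type} {c : I → Cone V} (F : MESPS c) (u : J → I)
    (hu : Function.Injective u) (i : I)
    (hΛ : ∀ k, Cone.IsProperFaceOf (c k) (c i) → k ∈ Set.range u)
    (f : (F.stalk i).M →ₗ[PolyRing V] (F.pull u).secSub (MESPS.bd (c i)))
    (hf : ∀ x, F.pullSec u _ (F.bdRes i x) = f x)
    (h : ∀ q, Set.BijOn (mRedMap V f) (mRedPiece V ((F.stalk i).deg q))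
      (mRedPiece V ((F.pull u).secDeg (MESPS.bd (c i)) q))) : F.LMEat i := by
  intro q
  exact (MES_transport (F.bdRes i) (F.pullSec u (MESPS.bd (c i)))
    (F.pullSec_bij u hu _ hΛ) f hf _ _ _
    (fun x => F.pullSec_deg u _ hΛ q x)).2 (h q)

/-! ## Adding one maximal cone -/

lemma MES_face_refl (σ : Cone V) : σ.IsFaceOf σ :=
  ⟨0, fun _ _ => le_rfl, by ext x; simp⟩

lemma MES_face_subset {τ σ : Cone V} (h : τ.IsFaceOf σ) : τ.carrier ⊆ σ.carrier := by
  obtain ⟨f, -, hf⟩ := h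
  rw [hf]
  exact Set.inter_subset_left

lemma MES_cone_ext {τ σ : Cone V} (h : τ.carrier = σ.carrier) : τ = σ := by
  cases τ; cases σ
  simp only at h
  subst h
  rfl

namespace MESPS

variable {I : Type} {c : I → Cone V} (F : MESPS c)

/-- Extended family of cones. -/
def extC (c : I → Cone V) (σ : Cone V) : Option I → Cone V
  | none => σ
  | some i => c i

/-- Extended stalks. -/
def extStalk (G : GAMod V) : Option I → GAMod V
  | none => G
  | some i => F.stalk i

/-- Evaluation of sections. -/
def evalSec (Λ : Set (Cone V)) (j : I) : F.secSub Λ →ₗ[PolyRing V] (F.stalk j).M where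
  toFun s := s.1 j
  map_add' _ _ := rfl
  map_smul' _ _ := rfl

/-- Extended restriction maps. -/
def extRes [Finite I] (σ : Cone V) (hσ : ∀ i, ¬ σ.IsFaceOf (c i)) (G : GAMod V)
    (φ : GHom G (F.secG (bd σ))) : ∀ a b : Option I,
    Cone.IsFaceOf (extC c σ b) (extC c σ a) → GHom (F.extStalk G a) (F.extStalk G b)
  | none, none, _ => GHom.id G
  | none, some j, _ =>
    ⟨F.evalSec (bd σ) j ∘ₗ φ.toLin,
      fun q x hx => φ.deg_mem q x hx j⟩
  | some i, none, h => absurd h (hσ i)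
  | some i, some j, h => F.res i j h

/-- The extended sheaf. -/
def ext [Finite I] (σ : Cone V) (hσ : ∀ i, ¬ σ.IsFaceOf (c i)) (G : GAMod V)
    (φ : GHom G (F.secG (bd σ))) : MESPS (extC c σ) where
  stalk := F.extStalk G
  res := F.extRes σ hσ G φ
  res_self := by
    rintro (_ | i) h
    · rfl
    · exact F.res_self i h
  res_comp := by
    rintro (_ | i) (_ | j) (_ | k) h1 h2 h3
    · rfl
    · rfl
    · exact absurd h2 (hσ j)
    · apply LinearMap.ext
      intro x
      have hne : ∀ i, c i ≠ σ := fun i h => hσ i (h ▸ MES_face_refl σ)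
      exact (φ.toLin x).2.2 j k ⟨h1, hne j⟩ ⟨h3, hne k⟩ h2
    · exact absurd h1 (hσ i)
    · exact absurd h1 (hσ i)
    · exact absurd h3 (hσ i)
    · exact F.res_comp i j k h1 h2 h3

lemma exists_ext [Finite I] (σ : Cone V) (hσ : ∀ i, ¬ σ.IsFaceOf (c i)) (h0 : σ ≠ zeroCone V)
    (hF : F.Good) : ∃ F' : MESPS (extC c σ), F'.Good := by
  have hne : ∀ i, c i ≠ σ := fun i h => hσ i (h ▸ MES_face_refl σ)
  have ht : Module.IsTorsionBySet (PolyRing V) (F.secG (bd σ)).M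
      (vanishingIdeal V σ.carrier) := by
    rintro s ⟨a, ha⟩
    apply Subtype.ext
    funext i
    change a • s.1 i = 0
    by_cases hi : c i ∈ bd σ
    · obtain ⟨hti, -⟩ := hF.2.1 i
      refine @hti (s.1 i) ⟨a, ?_⟩
      have ha' : a ∈ vanishingIdeal V σ.carrier := ha
      change a ∈ vanishingIdeal V (c i).carrier
      rw [MES_mem_vanishing] at ha' ⊢
      exact fun x hx => ha' x (MES_face_subset hi.1 hx)
    · rw [s.2.1 i hi, smul_zero]
  obtain ⟨G, φ, hfree, hbij⟩ := MES_core σ (F.secG (bd σ)) ht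
  let F' := F.ext σ hσ G φ
  have hpull : F'.pull some = F := rfl
  have hsome : Function.Injective (some : I → Option I) := Option.some_injective I
  refine ⟨F', ?_, ?_, ?_⟩
  · rintro (_ | i) hi
    · exact absurd hi h0
    · exact hF.1 i hi
  · rintro (_ | i)
    · exact hfree
    · exact hF.2.1 i
  · rintro (_ | i) hi
    · have hΛ : ∀ a : Option I, extC c σ a ∈ bd σ → a ∈ Set.range (some : I → Option I) := by
        rintro (_ | j) h
        · exact absurd rfl h.2
        · exact ⟨j, rfl⟩
      refine F'.LMEat_of some hsome none hΛ φ.toLin ?_ hbij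
      intro x
      apply Subtype.ext
      funext j
      by_cases hj : Cone.IsProperFaceOf (c j) σ
      · exact dif_pos hj
      · exact (dif_neg hj).trans ((φ.toLin x).2.1 j hj).symm
    · refine (F'.LMEat_pull some hsome i ?_).2 (hF.2.2 i hi)
      rintro (_ | j) h
      · exact absurd h.1 (hσ i)
      · exact ⟨j, rfl⟩

end MESPS

/-! ## The base case -/

lemma MES_base : ∃ F : MESPS (fun _ : Unit => zeroCone V), F.Good := by
  let G : GAMod V := MESfree (zeroCone V) (fun _ : Unit => (0 : ℤ))
  have hmk : ∀ a : PolyRing V, MESmk (zeroCone V) a = 0 ↔ (a : V → ℝ) 0 = 0 := by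
    intro a
    rw [MESmk_eq_zero]
    constructor
    · intro h; exact h 0 rfl
    · rintro h x rfl; exact h
  refine ⟨⟨fun _ => G, fun _ _ _ => GHom.id G, fun _ _ => rfl, fun _ _ _ _ _ _ => rfl⟩,
    ?_, fun _ => MES_freeOver _ _, fun _ h => absurd rfl h⟩
  rintro i -
  refine ⟨?_, ?_, ?_⟩
  · rintro s ⟨a, ha⟩
    refine @MES_torsion V _ _ (zeroCone V) Unit s ⟨a, ?_⟩
    have ha' : a ∈ mId V := ha
    change a ∈ vanishingIdeal V (zeroCone V).carrier
    rw [MES_mem_vanishing]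
    rw [MES_mem_mId] at ha'
    rintro x rfl
    exact ha'
  · change Module.finrank ℝ (Unit →₀ coneRing V (zeroCone V)) = 1
    rw [finrank_eq_one_iff']
    refine ⟨Finsupp.single () (MESmk _ 1), ?_, ?_⟩
    · rw [Ne, Finsupp.single_eq_zero, hmk]
      simp
    · intro w
      obtain ⟨a, ha⟩ := Ideal.Quotient.mk_surjective (w ())
      refine ⟨(a : V → ℝ) 0, ?_⟩
      ext
      rw [Finsupp.smul_apply, Finsupp.single_eq_same, ← map_smul]
      change _ = w ()
      rw [← ha]
      change _ = MESmk (zeroCone V) a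
      rw [← sub_eq_zero, ← map_sub, hmk]
      simp
  · intro q hq
    rw [eq_bot_iff]
    intro f hf
    change f = 0
    refine Finsupp.ext (M := coneRing V (zeroCone V)) ?_
    intro u
    obtain ⟨a, ha, hau⟩ := hf u
    rw [← hau]
    change MESmk (zeroCone V) a = 0
    rw [hmk]
    change a ∈ Adeg V (q - 0) at ha
    rw [sub_zero] at ha
    by_cases hk : ∃ k : ℕ, q = 2 * (k : ℤ)
    · obtain ⟨k, rfl⟩ := hk
      rw [MES_Adeg_even] at ha
      have h1 := ha 0 0
      have hk0 : k ≠ 0 := by rintro rfl; simp at hq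
      simpa [hk0] using h1
    · push Not at hk
      rw [MES_Adeg_odd q hk, Submodule.mem_bot] at ha
      simp [ha]

/-! ## Induction over face-closed sets of cones -/

lemma MES_induction (n : ℕ) : ∀ Λ : Set (Cone V), Λ.Finite → Λ.ncard = n → zeroCone V ∈ Λ →
    (∀ σ ∈ Λ, ∀ τ : Cone V, τ.IsFaceOf σ → τ ∈ Λ) →
    ∃ (I : Type) (c : I → Cone V), Finite I ∧ Function.Injective c ∧ Set.range c = Λ ∧
      ∃ F : MESPS c, F.Good := by
  induction n with
  | zero =>
    intro Λ hfin hcard h0 _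
    rw [Set.ncard_eq_zero hfin] at hcard
    rw [hcard] at h0
    exact absurd h0 (Set.notMem_empty _)
  | succ n ih =>
    intro Λ hfin hcard h0 hface
    obtain ⟨σ, hσ⟩ := hfin.exists_maximalFor Cone.carrier Λ ⟨_, h0⟩
    have hmax : ∀ τ ∈ Λ, σ.carrier ⊆ τ.carrier → τ = σ := by
      intro τ hτ h
      exact MES_cone_ext (Set.Subset.antisymm (hσ.2 hτ h) h)
    by_cases hz : σ = zeroCone V
    · have hΛ : Λ = {zeroCone V} := by
        ext τ
        constructor
        · intro hτ
          rw [Set.mem_singleton_iff, ← hz]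
          apply hmax τ hτ
          rw [hz]
          rintro x rfl
          exact MES_zero_mem τ
        · rintro rfl; exact h0
      refine ⟨Unit, fun _ => zeroCone V, inferInstance, fun _ _ _ => rfl, ?_, MES_base⟩
      rw [hΛ]; simp
    · have hnot : ∀ ρ ∈ Λ \ {σ}, ¬ σ.IsFaceOf ρ := fun ρ hρ h =>
        hρ.2 (hmax ρ hρ.1 (MES_face_subset h))
      obtain ⟨I, c, hI, hc, hr, F, hF⟩ := ih (Λ \ {σ}) (hfin.subset Set.sdiff_subset)
        (by rw [Set.ncard_sdiff_singleton_of_mem hσ.1, hcard]; rfl)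
        ⟨h0, fun h => hz h.symm⟩
        (by
          intro ρ hρ τ hτ
          refine ⟨hface ρ hρ.1 τ hτ, ?_⟩
          rintro rfl
          exact hnot ρ hρ hτ)
      have hcm : ∀ i, c i ∈ Λ \ {σ} := fun i => hr ▸ Set.mem_range_self i
      obtain ⟨F', hF'⟩ := F.exists_ext σ (fun i => hnot _ (hcm i)) hz hF
      refine ⟨Option I, MESPS.extC c σ, inferInstance, ?_, ?_, F', hF'⟩
      · rintro (_ | i) (_ | j) h
        · rfl
        · exact absurd h.symm (hcm j).2
        · exact absurd h (hcm i).2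
        · exact congrArg some (hc h)
      · ext τ
        constructor
        · rintro ⟨_ | i, rfl⟩
          · exact hσ.1
          · exact (hcm i).1
        · intro hτ
          by_cases h : τ = σ
          · exact ⟨none, h.symm⟩
          · have : τ ∈ Set.range c := by rw [hr]; exact ⟨hτ, h⟩
            obtain ⟨i, rfl⟩ := this
            exact ⟨some i, rfl⟩

lemma MES_final (Δ : Fan V) : ∃ F : FanSheaf Δ, F.IsMES := by
  obtain ⟨I, c, hI, hc, hr, F, hF⟩ :=
    MES_induction _ Δ.cones Δ.finite rfl Δ.zero_mem Δ.face_mem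
  have hex : ∀ σ : Δ.cones, ∃ i, c i = σ.1 := by
    rintro ⟨σ, hσ⟩
    rw [← hr] at hσ
    exact hσ
  choose u hu using hex
  have hinj : Function.Injective u := by
    intro σ τ h
    apply Subtype.ext
    rw [← hu, ← hu, h]
  have hsurj : ∀ i, i ∈ Set.range u := by
    intro i
    have hi : c i ∈ Δ.cones := hr ▸ Set.mem_range_self i
    exact ⟨⟨c i, hi⟩, hc (hu _)⟩
  have hgood : (F.pull u).Good :=
    ⟨fun j hj => hF.1 (u j) hj, fun j => hF.2.1 (u j),
      fun j hj => (F.LMEat_pull u hinj j (fun i _ => hsurj i)).1 (hF.2.2 (u j) hj)⟩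
  have hcu : (fun j => c (u j)) = (Subtype.val : Δ.cones → Cone V) := funext hu
  have hgen : ∀ (c' : Δ.cones → Cone V), c' = Subtype.val → ∀ F' : MESPS c', F'.Good →
      ∃ F : FanSheaf Δ, F.IsMES := by
    rintro _ rfl F' ⟨h1, h2, h3⟩
    refine ⟨⟨F'.stalk, F'.res, F'.res_self, F'.res_comp⟩, ?_, ?_, ?_⟩
    · exact h1 Δ.ozero rfl
    · exact h2
    · intro σ hσ q
      exact h3 σ hσ q
  exact hgen _ hcu _ hgood

/-- On every fan there exists a minimal extension sheaf. -/
theorem exists_minimal_extension_sheaf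
    {V : Type} [AddCommGroup V] [Module ℝ V] [FiniteDimensional ℝ V]
    (Δ : Fan V) : ∃ F : FanSheaf Δ, F.IsMES := by
  exact MES_final Δ

end
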